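/- arXiv:1510.00553 — 3 statements merged into one kernel-verified Lean document; each statement's English description precedes it below -/
import Mathlib

section
/- Fix real numbers Q₀ with 0 ≤ Q₀ < 1/2 and c with |c| ≤ 1. The function a(r) = (1 − 2r²)^{−3/2} · (1 + 2r²(1 − 4Q₀²) − 4√2 · Q₀ · r³ · c) is strictly increasing on the interval [0, 1/√2). -/
/-- For fixed real `Q₀` with `0 ≤ Q₀ < 1/2` and `c` with `|c| ≤ 1`, the
function `a(r) = (1 - 2r²)^{-3/2} (1 + 2r²(1 - 4Q₀²) - 4√2 Q₀ r³ c)` is strictly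
increasing on `[0, 1/√2)`. -/
theorem stmt11 (Q₀ c : ℝ) (hQ0 : 0 ≤ Q₀) (hQ1 : Q₀ < 1 / 2) (hc : |c| ≤ 1) :
    StrictMonoOn
      (fun r : ℝ =>
        (1 - 2 * r ^ 2) ^ (-(3 : ℝ) / 2) *
          (1 + 2 * r ^ 2 * (1 - 4 * Q₀ ^ 2) - 4 * Real.sqrt 2 * Q₀ * r ^ 3 * c))
      (Set.Ico 0 (1 / Real.sqrt 2)) := by
  have hs : 0 < Real.sqrt 2 := by positivity
  have hss : Real.sqrt 2 ^ 2 = 2 := Real.sq_sqrt (by norm_num)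
  have hlt : ∀ r ∈ Set.Ico 0 (1 / Real.sqrt 2), Real.sqrt 2 * r < 1 := fun r hr => by
    have := (lt_div_iff₀ hs).1 hr.2
    linarith
  have hu : ∀ r ∈ Set.Ico 0 (1 / Real.sqrt 2), 0 < 1 - 2 * r ^ 2 := fun r hr => by
    have h0 : 0 ≤ Real.sqrt 2 * r := mul_nonneg hs.le hr.1
    have h1 : (Real.sqrt 2 * r) ^ 2 = 2 * r ^ 2 := by rw [mul_pow, hss]
    nlinarith [hlt r hr]
  have hd : ∀ r ∈ Set.Ico 0 (1 / Real.sqrt 2), HasDerivAt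
      (fun r : ℝ =>
        (1 - 2 * r ^ 2) ^ (-(3 : ℝ) / 2) *
          (1 + 2 * r ^ 2 * (1 - 4 * Q₀ ^ 2) - 4 * Real.sqrt 2 * Q₀ * r ^ 3 * c))
      ((1 - 2 * r ^ 2) ^ (-(3 : ℝ) / 2 - 1) * (2 * r *
        (3 + 2 * (1 - 4 * Q₀ ^ 2) + 2 * (1 - 4 * Q₀ ^ 2) * r ^ 2
          - 6 * (Q₀ * (c * (Real.sqrt 2 * r)))))) r := fun r hr => by
    have h1 : HasDerivAt (fun r : ℝ => 1 - 2 * r ^ 2) (-(4 * r)) r := by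
      refine (((hasDerivAt_pow 2 r).const_mul 2).const_sub 1).congr_deriv ?_
      norm_num
      ring
    have h2 : HasDerivAt (fun r : ℝ =>
        1 + 2 * r ^ 2 * (1 - 4 * Q₀ ^ 2) - 4 * Real.sqrt 2 * Q₀ * r ^ 3 * c)
        (4 * r * (1 - 4 * Q₀ ^ 2) - 12 * Real.sqrt 2 * Q₀ * r ^ 2 * c) r := by
      refine (((((hasDerivAt_pow 2 r).const_mul 2).mul_const (1 - 4 * Q₀ ^ 2)).const_add 1).sub
        (((hasDerivAt_pow 3 r).const_mul (4 * Real.sqrt 2 * Q₀)).mul_const c)).congr_deriv ?_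
      norm_num
      ring
    have hpow : (1 - 2 * r ^ 2) ^ (-(3 : ℝ) / 2)
        = (1 - 2 * r ^ 2) ^ (-(3 : ℝ) / 2 - 1) * (1 - 2 * r ^ 2) := by
      rw [Real.rpow_sub_one (hu r hr).ne', div_mul_cancel₀ _ (hu r hr).ne']
    refine ((h1.rpow_const (p := -(3 : ℝ) / 2) (Or.inl (hu r hr).ne')).mul h2).congr_deriv ?_
    rw [hpow]
    ring
  refine strictMonoOn_of_deriv_pos (convex_Ico _ _)
    (fun r hr => (hd r hr).continuousAt.continuousWithinAt) fun r hr => ?_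
  have hr' := interior_subset hr
  rw [interior_Ico] at hr
  rw [(hd r hr').deriv]
  have hr0 : 0 < r := hr.1
  have hx0 : 0 ≤ Real.sqrt 2 * r := by positivity
  have hcx : c * (Real.sqrt 2 * r) ≤ 1 :=
    mul_le_one₀ (le_of_abs_le hc) hx0 (hlt r hr').le
  have hQcx : Q₀ * (c * (Real.sqrt 2 * r)) ≤ Q₀ := mul_le_of_le_one_right hQ0 hcx
  have hk : 0 < 1 - 4 * Q₀ ^ 2 := by nlinarith
  have hkr : 0 ≤ (1 - 4 * Q₀ ^ 2) * r ^ 2 := by positivity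
  refine mul_pos (Real.rpow_pos_of_pos (hu r hr') _) (mul_pos (by positivity) ?_)
  linarith
end

section
/- Let 0 ≤ Q₀ < 1/2, 0 ≤ r < 1/√2, and α ∈ ℝ. Set w₁ = r cos α, w₂ = r sin α, w = w₁ + i w₂, l = (1 + r²)/√2, k = −2Q₀ w − w̄²/√2 with k₁ = Re k, k₂ = Im k. Let M = [[2 − 4w₁², 4w₁w₂], [4w₁w₂, 2 − 4w₂²]] and B = [[l + k₁, k₂], [k₂, l − k₁]]. Then for every v ∈ ℝ², (1 − 2r²)^{−2} · ⟨v, Bᵀ M B v⟩ ≥ ((1 − 2Q₀)²/9) · ‖v‖². -/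
open Matrix

/-- A binary quadratic form dominates its determinant divided by any upper bound of its trace. -/
lemma det_mul_le_trace_bound_mul_form (E F H T x y : ℝ) (hT : E + H ≤ T)
    (hG : 0 ≤ E * x ^ 2 + 2 * F * x * y + H * y ^ 2) :
    (E * H - F ^ 2) * (x ^ 2 + y ^ 2) ≤ T * (E * x ^ 2 + 2 * F * x * y + H * y ^ 2) := by
  have h := mul_le_mul_of_nonneg_right hT hG
  nlinarith [sq_nonneg (E * x + F * y), sq_nonneg (F * x + H * y)]

lemma re_cube_le (X Y t : ℝ) (ht0 : 0 ≤ t) (ht : X ^ 2 + Y ^ 2 = t ^ 2) :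
    X ^ 3 - 3 * X * Y ^ 2 ≤ t ^ 3 := by
  refine le_of_abs_le (abs_le_of_sq_le_sq ?_ (by positivity))
  have : (t ^ 3) ^ 2 = (X ^ 2 + Y ^ 2) ^ 3 := by rw [ht]; ring
  rw [this]
  nlinarith [sq_nonneg (3 * X ^ 2 * Y - Y ^ 3)]

/-- The lower bound in the rescaled variables `X = √2 w₁`, `Y = √2 w₂`, `t = √2 r`,
`q = 2 Q₀`. -/
lemma rescaled_form_lower_bound (X Y q t x y L K J : ℝ) (ht0 : 0 ≤ t) (ht1 : t < 1)
    (hq0 : 0 ≤ q) (hq1 : q < 1) (ht : X ^ 2 + Y ^ 2 = t ^ 2)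
    (hL : L = 1 + t ^ 2 / 2) (hK : K = -q * X - (X ^ 2 - Y ^ 2) / 2) (hJ : J = -q * Y + X * Y) :
    (1 - q) ^ 2 / 9 * (x ^ 2 + y ^ 2) * (1 - t ^ 2) ^ 2 ≤
      (1 - X ^ 2) * ((L + K) * x + J * y) ^ 2
        + 2 * (X * Y) * ((L + K) * x + J * y) * (J * x + (L - K) * y)
        + (1 - Y ^ 2) * (J * x + (L - K) * y) ^ 2 := by
  have hC := re_cube_le X Y t ht0 ht
  set C := X ^ 3 - 3 * X * Y ^ 2 with hCdef
  have ht2 : 0 < 1 - t ^ 2 := by nlinarith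
  set E := (1 - X ^ 2) * (L + K) ^ 2 + 2 * (X * Y) * (L + K) * J + (1 - Y ^ 2) * J ^ 2 with hE
  set H := (1 - X ^ 2) * J ^ 2 + 2 * (X * Y) * J * (L - K) + (1 - Y ^ 2) * (L - K) ^ 2 with hH
  set F := (1 - X ^ 2) * (L + K) * J + X * Y * ((L + K) * (L - K) + J ^ 2)
    + (1 - Y ^ 2) * J * (L - K) with hF
  have hform : (1 - X ^ 2) * ((L + K) * x + J * y) ^ 2
        + 2 * (X * Y) * ((L + K) * x + J * y) * (J * x + (L - K) * y)
        + (1 - Y ^ 2) * (J * x + (L - K) * y) ^ 2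
      = E * x ^ 2 + 2 * F * x * y + H * y ^ 2 := by
    rw [hE, hF, hH]; ring
  have hpos : ∀ a b : ℝ, 0 ≤ (1 - X ^ 2) * a ^ 2 + 2 * (X * Y) * a * b + (1 - Y ^ 2) * b ^ 2 := by
    intro a b
    have h1 : 0 ≤ (1 - t ^ 2) * (a ^ 2 + b ^ 2) := by positivity
    rw [← ht] at h1
    nlinarith [sq_nonneg (a * Y + b * X)]
  have hdet : E * H - F ^ 2 = (1 - t ^ 2) * (L ^ 2 - K ^ 2 - J ^ 2) ^ 2 := by
    rw [hE, hF, hH, ← ht]; ring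
  have hD : L ^ 2 - K ^ 2 - J ^ 2 = 1 + t ^ 2 - q ^ 2 * t ^ 2 - q * C := by
    rw [hL, hK, hJ, hCdef, ← ht]; ring
  have htr : E + H = (1 - t ^ 2) * (1 + q ^ 2 * t ^ 2) + q ^ 2 * t ^ 2 + (1 + t ^ 2) ^ 2
      + 4 * q * C := by
    rw [hE, hH, hL, hK, hJ, hCdef, ← ht]; ring
  clear_value C E F H
  have hqC : q * C ≤ q * t ^ 3 := mul_le_mul_of_nonneg_left hC hq0
  have ht21 : t ^ 2 ≤ 1 := by linarith
  have ht31 : t ^ 3 ≤ 1 := pow_le_one₀ ht0 ht1.le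
  have hq21 : q ^ 2 ≤ 1 := pow_le_one₀ hq0 hq1.le
  have hqt : q * t ^ 3 ≤ t ^ 3 := mul_le_of_le_one_left (by positivity) hq1.le
  have htr9 : E + H ≤ 9 := by
    have h1 : q ^ 2 * (t ^ 2 * (2 - t ^ 2)) ≤ t ^ 2 * (2 - t ^ 2) :=
      mul_le_of_le_one_left (mul_nonneg (sq_nonneg t) (by linarith)) hq21
    rw [htr]
    linarith
  have hDge : 1 - q ≤ L ^ 2 - K ^ 2 - J ^ 2 := by
    have h1 : q ^ 2 * t ^ 2 ≤ t ^ 2 := mul_le_of_le_one_left (sq_nonneg t) hq21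
    have h2 : q * t ^ 3 ≤ q := mul_le_of_le_one_right hq0 ht31
    rw [hD]
    linarith
  have hD2 : (1 - q) ^ 2 ≤ (L ^ 2 - K ^ 2 - J ^ 2) ^ 2 :=
    pow_le_pow_left₀ (by linarith) hDge 2
  have hmain := det_mul_le_trace_bound_mul_form E F H 9 x y htr9 (hform ▸ hpos _ _)
  rw [hform]
  rw [hdet] at hmain
  have hstep : (1 - q) ^ 2 * (1 - t ^ 2) ^ 2 ≤ (1 - t ^ 2) * (L ^ 2 - K ^ 2 - J ^ 2) ^ 2 := by
    have h1 : (1 - t ^ 2) ^ 2 ≤ 1 - t ^ 2 :=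
      pow_le_of_le_one ht2.le (by linarith [sq_nonneg t]) two_ne_zero
    calc (1 - q) ^ 2 * (1 - t ^ 2) ^ 2 ≤ (L ^ 2 - K ^ 2 - J ^ 2) ^ 2 * (1 - t ^ 2) := by gcongr
      _ = _ := mul_comm _ _
  have hfin := mul_le_mul_of_nonneg_right hstep (by positivity : 0 ≤ x ^ 2 + y ^ 2)
  linarith

/-- With `0 ≤ Q₀ < 1/2`, `0 ≤ r < 1/√2`, `α ∈ ℝ`, `w₁ = r cos α`,
`w₂ = r sin α`, `w = w₁ + i w₂`, `l = (1 + r²)/√2`, `k = -2Q₀w - w̄²/√2` with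
`k₁ = Re k`, `k₂ = Im k`, `M = !![2 - 4w₁², 4w₁w₂; 4w₁w₂, 2 - 4w₂²]` and
`B = !![l + k₁, k₂; k₂, l - k₁]`, for every `v ∈ ℝ²` one has
`(1 - 2r²)⁻² ⟨v, Bᵀ M B v⟩ ≥ ((1 - 2Q₀)²/9) ‖v‖²`. -/
theorem stmt14 (Q₀ r α : ℝ) (hQ0 : 0 ≤ Q₀) (hQ1 : Q₀ < 1 / 2)
    (hr0 : 0 ≤ r) (hr1 : r < 1 / Real.sqrt 2)
    (w₁ w₂ l k₁ k₂ : ℝ) (w k : ℂ)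
    (hw1 : w₁ = r * Real.cos α) (hw2 : w₂ = r * Real.sin α)
    (hw : w = (w₁ : ℂ) + (w₂ : ℂ) * Complex.I)
    (hl : l = (1 + r ^ 2) / Real.sqrt 2)
    (hk : k = -2 * (Q₀ : ℂ) * w - (starRingEnd ℂ) w ^ 2 / (Real.sqrt 2 : ℂ))
    (hk1 : k₁ = k.re) (hk2 : k₂ = k.im)
    (M B : Matrix (Fin 2) (Fin 2) ℝ)
    (hM : M = !![2 - 4 * w₁ ^ 2, 4 * w₁ * w₂; 4 * w₁ * w₂, 2 - 4 * w₂ ^ 2])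
    (hB : B = !![l + k₁, k₂; k₂, l - k₁]) :
    ∀ v : Fin 2 → ℝ,
      (1 - 2 * Q₀) ^ 2 / 9 * (v ⬝ᵥ v) ≤
        ((1 - 2 * r ^ 2) ^ 2)⁻¹ * (v ⬝ᵥ (Bᵀ * M * B).mulVec v) := by
  intro v
  have hs : Real.sqrt 2 ^ 2 = 2 := Real.sq_sqrt (by norm_num)
  have hs0 : 0 < Real.sqrt 2 := by positivity
  set s := Real.sqrt 2 with hsdef
  have hrs : r * s < 1 := (lt_div_iff₀ hs0).mp hr1
  have hsq : w₁ ^ 2 + w₂ ^ 2 = r ^ 2 := by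
    rw [hw1, hw2]
    linear_combination r ^ 2 * Real.sin_sq_add_cos_sq α
  have hkk : k = ((-2 * Q₀ * w₁ - (w₁ ^ 2 - w₂ ^ 2) / s : ℝ) : ℂ)
      + ((-2 * Q₀ * w₂ + 2 * w₁ * w₂ / s : ℝ) : ℂ) * Complex.I := by
    rw [hk, hw]
    simp only [map_add, map_mul, Complex.conj_ofReal, Complex.conj_I]
    push_cast
    ring_nf
    rw [Complex.I_sq]
    ring
  have hk1' : k₁ = -2 * Q₀ * w₁ - (w₁ ^ 2 - w₂ ^ 2) / s := by
    rw [hk1, hkk]; simp only [Complex.add_re, Complex.ofReal_re, Complex.re_ofReal_mul, Complex.I_re]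
    ring
  have hk2' : k₂ = -2 * Q₀ * w₂ + 2 * w₁ * w₂ / s := by
    rw [hk2, hkk]; simp only [Complex.add_im, Complex.ofReal_im, Complex.im_ofReal_mul, Complex.I_im]
    ring
  have h := rescaled_form_lower_bound (s * w₁) (s * w₂) (2 * Q₀) (s * r) (v 0) (v 1)
    (s * l) (s * k₁) (s * k₂) (by positivity) (by linarith) (by linarith) (by linarith)
    (by linear_combination s ^ 2 * hsq)
    (by rw [hl]; field_simp; linear_combination (-r ^ 2) * hs)
    (by rw [hk1']; field_simp; linear_combination (w₁ ^ 2 - w₂ ^ 2) * hs)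
    (by rw [hk2']; field_simp; linear_combination (-w₁ * w₂) * hs)
  have hr2 : (s * r) ^ 2 = 2 * r ^ 2 := by rw [mul_pow, hs]
  have hpos : 0 < 1 - 2 * r ^ 2 := by
    rw [← hr2]
    nlinarith [mul_nonneg hs0.le hr0]
  rw [hr2] at h
  rw [← div_eq_inv_mul, le_div_iff₀ (by positivity)]
  have hv : v ⬝ᵥ v = v 0 ^ 2 + v 1 ^ 2 := by
    simp [dotProduct, Fin.sum_univ_two]; ring
  have hform : v ⬝ᵥ (Bᵀ * M * B).mulVec v =
      (2 - 4 * w₁ ^ 2) * ((l + k₁) * v 0 + k₂ * v 1) ^ 2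
        + 2 * (4 * w₁ * w₂) * ((l + k₁) * v 0 + k₂ * v 1) * (k₂ * v 0 + (l - k₁) * v 1)
        + (2 - 4 * w₂ ^ 2) * (k₂ * v 0 + (l - k₁) * v 1) ^ 2 := by
    rw [hM, hB]
    simp [dotProduct, mulVec, Matrix.mul_apply, Fin.sum_univ_two]
    ring
  rw [hv, hform]
  refine h.trans_eq ?_
  set a := (l + k₁) * v 0 + k₂ * v 1 with ha
  set b := k₂ * v 0 + (l - k₁) * v 1 with hb
  have h1 : (s * l + s * k₁) * v 0 + s * k₂ * v 1 = s * a := by rw [ha]; ring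
  have h2 : s * k₂ * v 0 + (s * l - s * k₁) * v 1 = s * b := by rw [hb]; ring
  rw [h1, h2]
  linear_combination (a ^ 2 + b ^ 2 + (2 + s ^ 2) * (2 * w₁ * w₂ * a * b - w₁ ^ 2 * a ^ 2 - w₂ ^ 2 * b ^ 2)) * hs
end

section
/- Let 0 ≤ Q₀ < 1/2, 0 ≤ r < 1/√2, α ∈ ℝ; set w₁ = r cos α, w₂ = r sin α, w = w₁ + i w₂, l = (1 + r²)/√2, k = −2Q₀ w − w̄²/√2 with k₁ = Re k and k₂ = Im k, M = [[2 − 4w₁², 4w₁w₂], [4w₁w₂, 2 − 4w₂²]], and B = [[l + k₁, k₂], [k₂, l − k₁]]. Then det( (1 − 2r²)^{−2} · Bᵀ M B ) = a(r)², where a(r) = (1 − 2r²)^{−3/2} · (1 + 2r²(1 − 4Q₀²) − 4√2 · Q₀ · r³ · cos(3α)). -/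
open Matrix

/-- With `0 ≤ Q₀ < 1/2`, `0 ≤ r < 1/√2`, `α ∈ ℝ`, `w₁ = r cos α`,
`w₂ = r sin α`, `w = w₁ + i w₂`, `l = (1 + r²)/√2`, `k = -2Q₀w - w̄²/√2` with
`k₁ = Re k`, `k₂ = Im k`, `M = !![2 - 4w₁², 4w₁w₂; 4w₁w₂, 2 - 4w₂²]` and
`B = !![l + k₁, k₂; k₂, l - k₁]`, one has
`det((1 - 2r²)⁻² • (Bᵀ M B)) = a(r)²` where
`a(r) = (1 - 2r²)^{-3/2}(1 + 2r²(1 - 4Q₀²) - 4√2 Q₀ r³ cos(3α))`. -/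
theorem stmt15 (Q₀ r α : ℝ) (hQ0 : 0 ≤ Q₀) (hQ1 : Q₀ < 1 / 2)
    (hr0 : 0 ≤ r) (hr1 : r < 1 / Real.sqrt 2)
    (w₁ w₂ l k₁ k₂ : ℝ) (w k : ℂ)
    (hw1 : w₁ = r * Real.cos α) (hw2 : w₂ = r * Real.sin α)
    (hw : w = (w₁ : ℂ) + (w₂ : ℂ) * Complex.I)
    (hl : l = (1 + r ^ 2) / Real.sqrt 2)
    (hk : k = -2 * (Q₀ : ℂ) * w - (starRingEnd ℂ) w ^ 2 / (Real.sqrt 2 : ℂ))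
    (hk1 : k₁ = k.re) (hk2 : k₂ = k.im)
    (M B : Matrix (Fin 2) (Fin 2) ℝ)
    (hM : M = !![2 - 4 * w₁ ^ 2, 4 * w₁ * w₂; 4 * w₁ * w₂, 2 - 4 * w₂ ^ 2])
    (hB : B = !![l + k₁, k₂; k₂, l - k₁]) :
    (((1 - 2 * r ^ 2) ^ 2)⁻¹ • (Bᵀ * M * B)).det =
      ((1 - 2 * r ^ 2) ^ (-(3 : ℝ) / 2) *
          (1 + 2 * r ^ 2 * (1 - 4 * Q₀ ^ 2) -
            4 * Real.sqrt 2 * Q₀ * r ^ 3 * Real.cos (3 * α))) ^ 2 := by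
  have hs : Real.sqrt 2 ^ 2 = 2 := Real.sq_sqrt zero_le_two
  have hd : 0 < 1 - 2 * r ^ 2 := by
    have h := (lt_div_iff₀ (by positivity)).1 hr1
    nlinarith [mul_nonneg hr0 (Real.sqrt_nonneg 2)]
  have hw12 : w₁ ^ 2 + w₂ ^ 2 = r ^ 2 := by
    rw [hw1, hw2]
    linear_combination r ^ 2 * Real.sin_sq_add_cos_sq α
  have hcos : r ^ 3 * Real.cos (3 * α) = w₁ ^ 3 - 3 * w₁ * w₂ ^ 2 := by
    rw [hw1, hw2, Real.cos_three_mul]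
    linear_combination 3 * r ^ 3 * Real.cos α * Real.sin_sq_add_cos_sq α
  have hk' : k = ((-2 * Q₀ * w₁ - (w₁ ^ 2 - w₂ ^ 2) / Real.sqrt 2 : ℝ) : ℂ) +
      ((-2 * Q₀ * w₂ + 2 * w₁ * w₂ / Real.sqrt 2 : ℝ) : ℂ) * Complex.I := by
    rw [hk, hw]
    simp only [map_add, map_mul, Complex.conj_ofReal, Complex.conj_I]
    push_cast
    linear_combination -((w₂ : ℂ) ^ 2 / (Real.sqrt 2 : ℂ)) * Complex.I_sq
  have hre : k₁ = -2 * Q₀ * w₁ - (w₁ ^ 2 - w₂ ^ 2) / Real.sqrt 2 := by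
    rw [hk1, hk']
    simp only [Complex.add_re, Complex.ofReal_re, Complex.re_ofReal_mul, Complex.I_re, mul_zero,
      add_zero]
  have him : k₂ = -2 * Q₀ * w₂ + 2 * w₁ * w₂ / Real.sqrt 2 := by
    rw [hk2, hk']
    simp only [Complex.add_im, Complex.ofReal_im, Complex.im_ofReal_mul, Complex.I_im, zero_add,
      mul_one]
  have hMdet : M.det = 4 * (1 - 2 * r ^ 2) := by
    rw [hM, Matrix.det_fin_two_of]
    linear_combination -8 * hw12
  have hBdet : B.det = (1 + 2 * r ^ 2 * (1 - 4 * Q₀ ^ 2) -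
      4 * Real.sqrt 2 * Q₀ * r ^ 3 * Real.cos (3 * α)) / 2 := by
    have hB' : B.det = ((1 + r ^ 2) ^ 2 - (w₁ ^ 2 + w₂ ^ 2) ^ 2) / Real.sqrt 2 ^ 2 -
        4 * Q₀ ^ 2 * (w₁ ^ 2 + w₂ ^ 2) -
        4 * Q₀ * (w₁ ^ 3 - 3 * w₁ * w₂ ^ 2) / Real.sqrt 2 := by
      rw [hB, Matrix.det_fin_two_of, hl, hre, him]
      field_simp
      ring
    rw [hB', hs, hw12, ← hcos]
    field_simp
    linear_combination 4 * Q₀ * r ^ 3 * Real.cos (3 * α) * hs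
  have hpow : ((1 - 2 * r ^ 2) ^ (-(3 : ℝ) / 2)) ^ 2 = ((1 - 2 * r ^ 2) ^ 3)⁻¹ := by
    rw [← Real.rpow_mul_natCast hd.le, ← Real.rpow_natCast (1 - 2 * r ^ 2) 3,
      ← Real.rpow_neg hd.le]
    norm_num
  rw [Matrix.det_smul, Matrix.det_mul, Matrix.det_mul, Matrix.det_transpose, hMdet, hBdet,
    mul_pow, hpow, Fintype.card_fin]
  field_simp
  ring
end
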